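/- Let G and H be connected finite simple graphs, where G has minimum degree d ≥ 1 and H has maximum degree Δ(H) ≥ d. Let S ⊆ V(H) be a maximum G-free subset of V(H); among all maximum G-free subsets, suppose S is chosen so that the induced subgraph H∖S has as few connected (Δ(H)−d)-regular subgraphs as possible, and subject to that, so that H[S] has the minimum possible number of connected components. If H∖S has a connected (Δ(H)−d)-regular subgraph, then one of the following holds: (i) G is isomorphic to K_{d+1} and H is isomorphic to K_{Δ(H)+1}; (ii) G is isomorphic to K_2 and H is isomorphic to an odd cycle C_{2ℓ+1} for some positive integer ℓ; or (iii) H is isomorphic to G. -/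

import Mathlib

open SimpleGraph

/-- `H` contains a subgraph isomorphic to `G`, i.e. there is an injective graph
homomorphism from `G` to `H`. -/
def HasCopy {α β : Type*} (G : SimpleGraph α) (H : SimpleGraph β) : Prop :=
  ∃ f : G →g H, Function.Injective f

/-- `S` is a `G`-free subset of the vertices of `H` of maximum cardinality. -/
def MaxFreeSubset {α V : Type*} (G : SimpleGraph α) (H : SimpleGraph V) (S : Set V) :
    Prop :=
  ¬ HasCopy G (H.induce S) ∧
    ∀ T : Set V, ¬ HasCopy G (H.induce T) → T.ncard ≤ S.ncard

/-- `H'` is a connected `r`-regular subgraph of `H ∖ S` (the subgraph of `H` induced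
on the complement of `S`). -/
def IsRegConnSubgraphOff {V : Type*} (H : SimpleGraph V) (S : Set V) (r : ℕ)
    (H' : H.Subgraph) : Prop :=
  H'.verts ⊆ Sᶜ ∧ H'.Connected ∧ ∀ v ∈ H'.verts, (H'.neighborSet v).ncard = r

/-- The number of connected `r`-regular subgraphs of `H ∖ S`. -/
noncomputable def regCount {V : Type*} (H : SimpleGraph V) (S : Set V) (r : ℕ) : ℕ :=
  {H' : H.Subgraph | IsRegConnSubgraphOff H S r H'}.ncard

/-- The number of connected components of the induced subgraph `H[S]`. -/
noncomputable def compCount {V : Type*} (H : SimpleGraph V) (S : Set V) : ℕ :=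
  Nat.card (H.induce S).ConnectedComponent


section Reach

variable {V : Type*} {H : SimpleGraph V}

/-- The set of vertices reachable from `x` by a walk staying in `A` after its first vertex. -/
def reachSet (H : SimpleGraph V) (A : Set V) (x : V) : Set V :=
  {y | Relation.ReflTransGen (fun a b => H.Adj a b ∧ b ∈ A) x y}

/-- `X` is closed under taking neighbours that lie in `A`. -/
def ClosedIn (H : SimpleGraph V) (A X : Set V) : Prop :=
  ∀ a ∈ X, ∀ b ∈ A, H.Adj a b → b ∈ X

/-- The vertex set `A` is nonempty and induces a connected subgraph. -/
def ConnOn (H : SimpleGraph V) (A : Set V) : Prop :=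
  A.Nonempty ∧ ∀ X ⊆ A, X.Nonempty → ClosedIn H A X → A ⊆ X

lemma self_mem_reachSet (A : Set V) (x : V) : x ∈ reachSet H A x := Relation.ReflTransGen.refl

lemma closedIn_reachSet (A : Set V) (x : V) : ClosedIn H A (reachSet H A x) :=
  fun _ ha _ hb hab => Relation.ReflTransGen.tail ha ⟨hab, hb⟩

lemma mem_reachSet_of_adj {A : Set V} {x y : V} (hy : y ∈ A) (h : H.Adj x y) :
    y ∈ reachSet H A x :=
  closedIn_reachSet A x x (self_mem_reachSet A x) y hy h

lemma reachSet_subset_of_closedIn {A X : Set V} {x : V} (hx : x ∈ X) (hX : ClosedIn H A X) :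
    reachSet H A x ⊆ X := by
  intro y hy
  induction hy with
  | refl => exact hx
  | tail _ h ih => exact hX _ ih _ h.2 h.1

lemma reachSet_subset {A : Set V} {x : V} (hx : x ∈ A) : reachSet H A x ⊆ A :=
  reachSet_subset_of_closedIn hx fun _ _ _ hb _ => hb

lemma connOn_reachSet (A : Set V) (x : V) : ConnOn H (reachSet H A x) := by
  refine ⟨⟨x, self_mem_reachSet A x⟩, fun X hXs ⟨p, hp⟩ hX => ?_⟩
  have hxX : x ∈ X := by
    by_contra hxX
    have : reachSet H A x ⊆ reachSet H A x \ X := by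
      refine reachSet_subset_of_closedIn ⟨self_mem_reachSet A x, hxX⟩ ?_
      intro a ha b hb hab
      refine ⟨closedIn_reachSet A x a ha.1 b hb hab, fun hbX => ha.2 (hX b hbX a ha.1 hab.symm)⟩
    exact (this (hXs hp)).2 hp
  refine reachSet_subset_of_closedIn hxX ?_
  intro a ha b hb hab
  exact hX a ha b (closedIn_reachSet A x a (hXs ha) b hb hab) hab

lemma ConnOn.subset_of_closedIn {A C X : Set V} (hC : ConnOn H C) (hCA : C ⊆ A)
    (hX : ClosedIn H A X) {y : V} (hyC : y ∈ C) (hyX : y ∈ X) : C ⊆ X := by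
  have := hC.2 (C ∩ X) Set.inter_subset_left ⟨y, hyC, hyX⟩
    (fun a ha b hb hab => ⟨hb, hX a ha.2 b (hCA hb) hab⟩)
  exact fun z hz => (this hz).2

lemma ConnOn.subset_reachSet {A C : Set V} (hC : ConnOn H C) (hCA : C ⊆ A) {y x : V}
    (hyC : y ∈ C) (hy : y ∈ reachSet H A x) : C ⊆ reachSet H A x :=
  hC.subset_of_closedIn hCA (closedIn_reachSet A x) hyC hy

lemma ConnOn.eq_of_closedIn {A C D : Set V} (hC : ConnOn H C) (hD : ConnOn H D) (hCA : C ⊆ A)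
    (hDA : D ⊆ A) (hCc : ClosedIn H A C) (hDc : ClosedIn H A D) {y : V} (hyC : y ∈ C)
    (hyD : y ∈ D) : C = D :=
  (hC.subset_of_closedIn hCA hDc hyC hyD).antisymm (hD.subset_of_closedIn hDA hCc hyD hyC)

lemma reachSet_eq_of_mem {A : Set V} {x y : V} (hx : x ∈ A) (hy : y ∈ reachSet H A x) :
    reachSet H A y = reachSet H A x :=
  (connOn_reachSet A y).eq_of_closedIn (connOn_reachSet A x)
    (reachSet_subset (reachSet_subset hx hy)) (reachSet_subset hx) (closedIn_reachSet A y)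
    (closedIn_reachSet A x) (self_mem_reachSet A y) hy

lemma connOn_singleton (x : V) : ConnOn H {x} := by
  refine ⟨⟨x, rfl⟩, fun X hX ⟨p, hp⟩ _ => ?_⟩
  have := hX hp
  simp_all

lemma ConnOn.insert_of_adj {X : Set V} (hX : ConnOn H X) {a b : V} (ha : a ∈ X) (hab : H.Adj a b) :
    ConnOn H (insert b X) := by
  refine ⟨⟨b, Set.mem_insert b X⟩, fun Y hY ⟨p, hp⟩ hYc => ?_⟩
  have haY : a ∈ Y := by
    rcases hY hp with rfl | hpX
    · exact hYc p hp a (Set.mem_insert_of_mem _ ha) hab.symm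
    · exact hX.subset_of_closedIn (Set.subset_insert b X) hYc hpX hp ha
  exact Set.insert_subset (hYc a haY b (Set.mem_insert b X) hab)
    (hX.subset_of_closedIn (Set.subset_insert b X) hYc ha haY)

lemma ConnOn.exists_connOn_diff_singleton [Finite V] {C : Set V} (hC : ConnOn H C) {x : V}
    (hx : x ∈ C) (hne : (C \ {x}).Nonempty) : ∃ u ∈ C, u ≠ x ∧ ConnOn H (C \ {u}) := by
  obtain ⟨X, ⟨hXC, hxX, hX⟩, hmax⟩ :=
    Set.Finite.exists_maximalFor Set.ncard {X : Set V | X ⊂ C ∧ x ∈ X ∧ ConnOn H X}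
      (Set.toFinite _) ⟨{x}, ⟨by simpa using hx, fun h => hne.ne_empty (Set.sdiff_eq_empty.2 h)⟩,
        rfl, connOn_singleton x⟩
  have : ∃ a ∈ X, ∃ b ∈ C, H.Adj a b ∧ b ∉ X := by
    by_contra! hcon
    exact hXC.2 (hC.2 X hXC.1 ⟨x, hxX⟩ hcon)
  obtain ⟨a, ha, b, hb, hab, hbX⟩ := this
  have heq : insert b X = C := by
    by_contra hneq
    have hlt := hmax (j := insert b X) ⟨(Set.insert_subset hb hXC.1).ssubset_of_ne hneq,
      Set.mem_insert_of_mem _ hxX, hX.insert_of_adj ha hab⟩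
    rw [Set.ncard_insert_of_notMem hbX] at hlt
    omega
  refine ⟨b, hb, fun h => hbX (h ▸ hxX), ?_⟩
  rw [← heq, Set.insert_sdiff_self_of_notMem hbX]
  exact hX

lemma SimpleGraph.Connected.eq_univ_of_closed (hH : H.Connected) {X : Set V} {x : V} (hx : x ∈ X)
    (hX : ∀ a ∈ X, ∀ b, H.Adj a b → b ∈ X) : X = Set.univ := by
  refine Set.eq_univ_of_forall fun y => ?_
  obtain ⟨p⟩ := hH.preconnected x y
  induction p with
  | nil => exact hx
  | cons h _ ih => exact ih (hX _ hx _ h)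

/-- The set of connected components of the subgraph induced on `A`. -/
def componentSets (H : SimpleGraph V) (A : Set V) : Set (Set V) :=
  {Z | Z ⊆ A ∧ ConnOn H Z ∧ ClosedIn H A Z}

lemma mem_componentSets_diff {A C Z : Set V} (hC : C ∈ componentSets H A) {p : V} (hp : p ∈ C)
    (hZ : Z ∈ componentSets H A) (hZC : Z ≠ C) : Z ∈ componentSets H (A \ {p}) := by
  have hpZ : p ∉ Z := fun h => hZC
    (hZ.2.1.eq_of_closedIn hC.2.1 hZ.1 hC.1 hZ.2.2 hC.2.2 h hp)
  exact ⟨fun z hz => ⟨hZ.1 hz, fun h => hpZ (h ▸ hz)⟩, hZ.2.1,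
    fun a ha b hb hab => hZ.2.2 a ha b hb.1 hab⟩

lemma disjoint_of_mem_componentSets {A C Z : Set V} (hC : C ∈ componentSets H A)
    (hZ : Z ∈ componentSets H A) (hZC : Z ≠ C) {y : V} (hyZ : y ∈ Z) : y ∉ C := fun h => hZC
    (hZ.2.1.eq_of_closedIn hC.2.1 hZ.1 hC.1 hZ.2.2 hC.2.2 hyZ h)

lemma ncard_componentSets_le [Finite V] {A C : Set V} (hC : C ∈ componentSets H A) {x y : V}
    (hx : x ∈ C) (hy : y ∈ C) (hCy : ConnOn H (C \ {y})) :
    (componentSets H (A \ {y})).ncard ≤ (componentSets H (A \ {x})).ncard ∧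
      ((componentSets H (A \ {x})).ncard ≤ (componentSets H (A \ {y})).ncard →
        ConnOn H (C \ {x})) := by
  set O := componentSets H A \ {C} with hO
  have hupper : componentSets H (A \ {y}) ⊆ insert (C \ {y}) O := by
    rintro Z ⟨hZA, hZc, hZ⟩
    by_cases hmeet : ∃ p ∈ Z, p ∈ C
    · obtain ⟨p, hpZ, hpC⟩ := hmeet
      left
      refine hZc.eq_of_closedIn hCy hZA (Set.sdiff_subset_sdiff_left hC.1) hZ ?_ hpZ
        ⟨hpC, (hZA hpZ).2⟩
      exact fun a ha b hb hab => ⟨hC.2.2 a ha.1 b hb.1 hab, hb.2⟩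
    · push Not at hmeet
      right
      refine ⟨⟨fun z hz => (hZA hz).1, hZc, fun a ha b hb hab => ?_⟩, ?_⟩
      · refine hZ a ha b ⟨hb, fun hby => ?_⟩ hab
        rw [Set.mem_singleton_iff] at hby
        subst hby
        exact hmeet a ha (hC.2.2 b hy a (hZA ha).1 hab.symm)
      · rintro rfl
        obtain ⟨p, hp⟩ := hZc.1
        exact hmeet p hp hp
  have hne : (C \ {x}).Nonempty := by
    by_cases hxy : x = y
    · subst hxy; exact hCy.1
    · exact ⟨y, hy, fun h => hxy h.symm⟩
  obtain ⟨p, hpC, hpx⟩ := hne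
  have hpA : p ∈ A \ {x} := ⟨hC.1 hpC, hpx⟩
  have hcomp : ∀ q ∈ A \ {x}, reachSet H (A \ {x}) q ∈ componentSets H (A \ {x}) := fun q hq =>
    ⟨reachSet_subset hq, connOn_reachSet _ q, closedIn_reachSet _ _⟩
  have hnot : ∀ q ∈ C, reachSet H (A \ {x}) q ∉ O := fun q hq h =>
    disjoint_of_mem_componentSets hC h.1 h.2 (self_mem_reachSet _ q) hq
  have hlower : insert (reachSet H (A \ {x}) p) O ⊆ componentSets H (A \ {x}) :=
    Set.insert_subset (hcomp p hpA) fun Z hZ => mem_componentSets_diff hC hx hZ.1 hZ.2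
  have hcard : (insert (reachSet H (A \ {x}) p) O).ncard = O.ncard + 1 :=
    Set.ncard_insert_of_notMem (hnot p hpC)
  have h1 := Set.ncard_le_ncard hupper
  have h2 := Set.ncard_le_ncard hlower
  have h3 := Set.ncard_insert_le (C \ {y}) O
  refine ⟨by omega, fun hle => ?_⟩
  have heq := Set.eq_of_subset_of_ncard_le hlower (by omega)
  have : C \ {x} = reachSet H (A \ {x}) p := by
    refine Set.Subset.antisymm (fun q hq => ?_) ?_
    · have hq' := hcomp q ⟨hC.1 hq.1, hq.2⟩
      rw [← heq] at hq'
      rcases hq' with hq' | hq'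
      · rw [← hq']; exact self_mem_reachSet _ q
      · exact absurd hq' (hnot q hq.1)
    · exact reachSet_subset_of_closedIn ⟨hpC, hpx⟩
        fun a ha b hb hab => ⟨hC.2.2 a ha.1 b hb.1 hab, hb.2⟩
  rw [this]
  exact connOn_reachSet _ p

end Reach

section SwapSystem

variable {V : Type*} {H : SimpleGraph V} {d r : ℕ}

lemma adj_iff_of_ncard_insert_eq [Finite V] {L : Set V} {y p q : V} {k : ℕ} (hp : p ∉ L)
    (hq : q ∉ L) (h₁ : (H.neighborSet y ∩ insert p L).ncard = k)
    (h₂ : (H.neighborSet y ∩ insert q L).ncard = k) : H.Adj y p ↔ H.Adj y q := by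
  have key : ∀ s ∉ L, (H.Adj y s → (H.neighborSet y ∩ insert s L).ncard =
      (H.neighborSet y ∩ L).ncard + 1) ∧ (¬ H.Adj y s →
      (H.neighborSet y ∩ insert s L).ncard = (H.neighborSet y ∩ L).ncard) := by
    intro s hs
    refine ⟨fun h => ?_, fun h => ?_⟩
    · rw [Set.inter_insert_of_mem (by simpa using h), Set.ncard_insert_of_notMem fun h' => hs h'.2]
    · rw [Set.inter_insert_of_notMem (by simpa using h)]
  have hp' := key p hp
  have hq' := key q hq
  by_cases h : H.Adj y p <;> by_cases h' : H.Adj y q <;> simp_all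

lemma adj_iff_of_ncard_diff_eq [Finite V] {A : Set V} {y p q : V} {k : ℕ} (hp : p ∈ A) (hq : q ∉ A)
    (h₁ : (H.neighborSet y ∩ A).ncard = k)
    (h₂ : (H.neighborSet y ∩ insert q (A \ {p})).ncard = k) : H.Adj y p ↔ H.Adj y q := by
  refine adj_iff_of_ncard_insert_eq (L := A \ {p}) (by simp) (fun h => hq h.1) ?_ h₂
  rwa [Set.insert_sdiff_singleton, Set.insert_eq_of_mem hp]

/-- A family of covers `A ∪ B` of the vertex set by two sets sharing exactly one vertex `x`, such
that `x` has `d` neighbours in `A` and `r` in `B`, and closed under exchanging `x` with any vertex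
of its component in `A` or in `B`. -/
structure SwapSystem (H : SimpleGraph V) (d r : ℕ) (W : V → Set V → Set V → Prop) : Prop where
  inter : ∀ {x A B}, W x A B → A ∩ B = {x}
  union : ∀ {x A B}, W x A B → A ∪ B = Set.univ
  degLeft : ∀ {x A B}, W x A B → (H.neighborSet x ∩ A).ncard = d
  degRight : ∀ {x A B}, W x A B → (H.neighborSet x ∩ B).ncard = r
  moveLeft : ∀ {x A B y}, W x A B → y ∈ reachSet H A x → W y A (insert y (B \ {x}))
  moveRight : ∀ {x A B y}, W x A B → y ∈ reachSet H B x → W y (insert y (A \ {x})) B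

/-- The number of components left on the two sides of a cover when the common vertex is removed. -/
noncomputable def coverPotential (H : SimpleGraph V) (x : V) (A B : Set V) : ℕ :=
  (componentSets H (A \ {x})).ncard + (componentSets H (B \ {x})).ncard

/-- A member of the family minimizing `coverPotential`. -/
def IsTight (H : SimpleGraph V) (W : V → Set V → Set V → Prop) (x : V) (A B : Set V) : Prop :=
  W x A B ∧ ∀ y A' B', W y A' B' → coverPotential H x A B ≤ coverPotential H y A' B'

namespace SwapSystem

variable {W : V → Set V → Set V → Prop} {x v w y : V} {A B A' B' : Set V}

lemma symm (hs : SwapSystem H d r W) : SwapSystem H r d (fun x A B => W x B A) where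
  inter h := by rw [Set.inter_comm]; exact hs.inter h
  union h := by rw [Set.union_comm]; exact hs.union h
  degLeft h := hs.degRight h
  degRight h := hs.degLeft h
  moveLeft h hy := hs.moveRight h hy
  moveRight h hy := hs.moveLeft h hy

lemma mem_left (hs : SwapSystem H d r W) (h : W x A B) : x ∈ A := by
  have : x ∈ A ∩ B := by rw [hs.inter h]; rfl
  exact this.1

lemma mem_right (hs : SwapSystem H d r W) (h : W x A B) : x ∈ B := hs.symm.mem_left h

lemma eq_of_mem (hs : SwapSystem H d r W) (h : W x A B) (hA : y ∈ A) (hB : y ∈ B) : y = x := by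
  have : y ∈ A ∩ B := ⟨hA, hB⟩
  rwa [hs.inter h] at this

lemma mem_or_mem (hs : SwapSystem H d r W) (h : W x A B) (y : V) : y ∈ A ∨ y ∈ B := by
  have : y ∈ A ∪ B := by rw [hs.union h]; trivial
  exact this

lemma degLeft_of_mem (hs : SwapSystem H d r W) (h : W x A B) (hy : y ∈ reachSet H A x) :
    (H.neighborSet y ∩ A).ncard = d := hs.degLeft (hs.moveLeft h hy)

lemma degRight_of_mem (hs : SwapSystem H d r W) (h : W x A B) (hy : y ∈ reachSet H B x) :
    (H.neighborSet y ∩ B).ncard = r := hs.symm.degLeft_of_mem h hy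

lemma degRight_of_mem_left (hs : SwapSystem H d r W) (h : W x A B) (hy : y ∈ reachSet H A x) :
    (H.neighborSet y ∩ insert y (B \ {x})).ncard = r := hs.degRight (hs.moveLeft h hy)

lemma degLeft_of_mem_right (hs : SwapSystem H d r W) (h : W x A B) (hy : y ∈ reachSet H B x) :
    (H.neighborSet y ∩ insert y (A \ {x})).ncard = d := hs.symm.degRight_of_mem_left h hy

lemma exists_adj_left [Finite V] (hs : SwapSystem H d r W) (hd : 1 ≤ d) (h : W x A B) :
    ∃ z ∈ A, H.Adj x z := by
  have : (H.neighborSet x ∩ A).Nonempty := by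
    rw [← Set.ncard_pos, hs.degLeft h]; exact hd
  obtain ⟨z, hz, hzA⟩ := this
  exact ⟨z, hzA, hz⟩

lemma ncard_neighborSet [Finite V] (hs : SwapSystem H d r W) (h : W x A B) :
    (H.neighborSet x).ncard = d + r := by
  have hdisj : Disjoint (H.neighborSet x ∩ A) (H.neighborSet x ∩ B) := by
    rw [Set.disjoint_left]
    rintro y ⟨hxy, hA⟩ ⟨-, hB⟩
    exact H.ne_of_adj hxy (hs.eq_of_mem h hA hB).symm
  have := Set.ncard_union_eq hdisj
  rwa [← Set.inter_union_distrib_left, hs.union h, Set.inter_univ, hs.degLeft h,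
    hs.degRight h] at this

lemma exists_state (hs : SwapSystem H d r W) (hH : H.Connected) (h : W x A B) (y : V) :
    ∃ A' B', W y A' B' := by
  have : {y | ∃ A' B', W y A' B'} = Set.univ := by
    refine hH.eq_univ_of_closed (x := x) ⟨A, B, h⟩ ?_
    rintro a ⟨A', B', ha⟩ b hab
    rcases hs.mem_or_mem ha b with hb | hb
    · exact ⟨_, _, hs.moveLeft ha (mem_reachSet_of_adj hb hab)⟩
    · exact ⟨_, _, hs.moveRight ha (mem_reachSet_of_adj hb hab)⟩
  have hy : y ∈ {y | ∃ A' B', W y A' B'} := this ▸ Set.mem_univ y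
  exact hy

/-- If `w ∈ B` is adjacent to `v` and has the same neighbours in `A`, these form a clique. -/
lemma adj_of_twin [Finite V] (hs : SwapSystem H d r W) (h : W v A B) (hwB : w ∈ B)
    (hvw : H.Adj v w) (htw : ∀ z ∈ A, z ≠ v → (H.Adj v z ↔ H.Adj w z)) {z z' : V} (hz : z ∈ A)
    (hz' : z' ∈ A) (hvz : H.Adj v z) (hvz' : H.Adj v z') (hne : z ≠ z') : H.Adj z z' := by
  have hwA : w ∉ A := fun hwA => hvw.ne (hs.eq_of_mem h hwA hwB).symm
  have hwz := (htw z hz hvz.ne').1 hvz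
  have hwz' := (htw z' hz' hvz'.ne').1 hvz'
  have h₁ := hs.moveLeft h (mem_reachSet_of_adj hz hvz)
  have h₂ := hs.moveRight h₁
    (mem_reachSet_of_adj (Set.mem_insert_of_mem _ ⟨hwB, hvw.ne'⟩) hwz.symm)
  have hdeg := hs.degLeft_of_mem h₂ (mem_reachSet_of_adj
    (Set.mem_insert_of_mem _ ⟨hz', hne.symm⟩) hwz')
  exact ((adj_iff_of_ncard_diff_eq hz hwA
    (hs.degLeft_of_mem h (mem_reachSet_of_adj hz' hvz')) hdeg).2 hwz'.symm).symm

lemma subset_reachSet_move (hs : SwapSystem H d r W) (h : W v A B)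
    (hconn : ConnOn H (reachSet H B v \ {v})) {z : V} (hw : w ∈ reachSet H B v) (hwv : w ≠ v)
    (hzw : H.Adj z w) : reachSet H B v \ {v} ⊆ reachSet H (insert z (B \ {v})) z := by
  have hsub : reachSet H B v \ {v} ⊆ insert z (B \ {v}) := fun y hy =>
    Set.mem_insert_of_mem _ ⟨reachSet_subset (hs.mem_right h) hy.1, hy.2⟩
  exact hconn.subset_reachSet hsub ⟨hw, hwv⟩ (mem_reachSet_of_adj (hsub ⟨hw, hwv⟩) hzw)

/-- If the component of `v` in `B` stays connected without `v`, then any `z` in the component of `v`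
in `A` with a neighbour in it has the same neighbours in `B` as `v`. -/
lemma twin_of_adj [Finite V] (hs : SwapSystem H d r W) (h : W v A B)
    (hconn : ConnOn H (reachSet H B v \ {v})) {z : V} (hz : z ∈ reachSet H A v) (hzv : z ≠ v)
    (hw : w ∈ reachSet H B v) (hwv : w ≠ v) (hzw : H.Adj z w) :
    ∀ y ∈ B, y ≠ v → (H.Adj v y ↔ H.Adj z y) := by
  have hzB : z ∉ B := fun hzB =>
    hzv (hs.eq_of_mem h (reachSet_subset (hs.mem_left h) hz) hzB)
  have h₁ := hs.moveLeft h hz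
  have hsub := hs.subset_reachSet_move h hconn hw hwv hzw
  have hiff : ∀ y ∈ reachSet H B v, y ≠ v → (H.Adj y v ↔ H.Adj y z) := fun y hy hyv =>
    adj_iff_of_ncard_diff_eq (hs.mem_right h) hzB (hs.degRight_of_mem h hy)
      (hs.degRight_of_mem h₁ (hsub ⟨hy, hyv⟩))
  have hle : H.neighborSet v ∩ B ⊆ H.neighborSet z ∩ insert z (B \ {v}) := by
    rintro y ⟨hvy, hyB⟩
    have hvy' : H.Adj v y := hvy
    exact ⟨((hiff y (mem_reachSet_of_adj hyB hvy') hvy'.ne').1 hvy'.symm).symm,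
      Set.mem_insert_of_mem _ ⟨hyB, hvy'.ne'⟩⟩
  have heq := Set.eq_of_subset_of_ncard_le hle (by rw [hs.degRight h, hs.degRight h₁])
  intro y hyB hyv
  constructor
  · intro hvy
    exact ((hiff y (mem_reachSet_of_adj hyB hvy) hyv).1 hvy.symm).symm
  · intro hzy
    have : y ∈ H.neighborSet v ∩ B := by
      rw [heq]; exact ⟨hzy, Set.mem_insert_of_mem _ ⟨hyB, hyv⟩⟩
    exact this.1

theorem eq_top_of_twin [Finite V] (hs : SwapSystem H d r W) (hH : H.Connected) (hd : 1 ≤ d)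
    (h : W v A B) (hconn : ConnOn H (reachSet H B v \ {v})) (hwB : w ∈ B) (hvw : H.Adj v w)
    (htw : ∀ z ∈ A, z ≠ v → (H.Adj v z ↔ H.Adj w z)) : H = ⊤ := by
  have hwv := mem_reachSet_of_adj hwB hvw
  have htw' : ∀ z ∈ A, H.Adj v z → ∀ y ∈ B, y ≠ v → (H.Adj v y ↔ H.Adj z y) := fun z hzA hvz =>
    hs.twin_of_adj h hconn (mem_reachSet_of_adj hzA hvz) hvz.ne' hwv hvw.ne'
      ((htw z hzA hvz.ne').1 hvz).symm
  obtain ⟨z₀, hz₀, hvz₀⟩ := hs.exists_adj_left hd h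
  have hcl : ∀ a b, H.Adj v a → H.Adj v b → a ≠ b → H.Adj a b := by
    intro a b ha hb hab
    rcases hs.mem_or_mem h a with haA | haB <;> rcases hs.mem_or_mem h b with hbA | hbB
    · exact hs.adj_of_twin h hwB hvw htw haA hbA ha hb hab
    · exact (htw' a haA ha b hbB hb.ne').1 hb
    · exact ((htw' b hbA hb a haB ha.ne').1 ha).symm
    · exact hs.symm.adj_of_twin h hz₀ hvz₀ (htw' z₀ hz₀ hvz₀) haB hbB ha hb hab
  have hcl' : ∀ a ∈ insert v (H.neighborSet v), ∀ b ∈ insert v (H.neighborSet v), a ≠ b →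
      H.Adj a b := by
    rintro a (rfl | ha) b (rfl | hb) hab
    · exact absurd rfl hab
    · exact hb
    · exact ha.symm
    · exact hcl a b ha hb hab
  have huniv : insert v (H.neighborSet v) = Set.univ := by
    refine hH.eq_univ_of_closed (Set.mem_insert v _) fun a ha b hab => ?_
    obtain ⟨A₁, B₁, h₁⟩ := hs.exists_state hH h a
    have hsub : insert v (H.neighborSet v) \ {a} ⊆ H.neighborSet a := fun c hc =>
      hcl' a ha c hc.1 fun h => hc.2 h.symm
    have hcard := Set.ncard_sdiff_singleton_add_one ha
    rw [Set.ncard_insert_of_notMem (by simp), hs.ncard_neighborSet h] at hcard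
    have heq := Set.eq_of_subset_of_ncard_le hsub (by rw [hs.ncard_neighborSet h₁]; omega)
    have hb : b ∈ insert v (H.neighborSet v) \ {a} := by rw [heq]; exact hab
    exact hb.1
  ext a b
  rw [SimpleGraph.top_adj]
  exact ⟨fun h => h.ne, hcl' a (huniv ▸ Set.mem_univ a) b (huniv ▸ Set.mem_univ b)⟩

lemma _root_.IsTight.symm (h : IsTight H W x A B) : IsTight H (fun x A B => W x B A) x B A := by
  refine ⟨h.1, fun y A' B' h' => ?_⟩
  have := h.2 y B' A' h'
  unfold coverPotential at *
  omega

lemma diff_insert_diff (hs : SwapSystem H d r W) (h : W x A B) {u : V} (hu : u ∈ reachSet H A x) :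
    insert u (B \ {x}) \ {u} = B \ {x} := by
  refine Set.insert_sdiff_self_of_notMem fun huB => huB.2 ?_
  exact hs.eq_of_mem h (reachSet_subset (hs.mem_left h) hu) huB.1

lemma reachSet_mem_componentSets (hs : SwapSystem H d r W) (h : W x A B) :
    reachSet H A x ∈ componentSets H A :=
  ⟨reachSet_subset (hs.mem_left h), connOn_reachSet A x, closedIn_reachSet A x⟩

lemma reachSet_diff_nonempty [Finite V] (hs : SwapSystem H d r W) (hd : 1 ≤ d) (h : W x A B) :
    (reachSet H A x \ {x}).Nonempty := by
  obtain ⟨z, hz, hxz⟩ := hs.exists_adj_left hd h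
  exact ⟨z, mem_reachSet_of_adj hz hxz, hxz.ne'⟩

lemma connOn_of_isTight [Finite V] (hs : SwapSystem H d r W) (hd : 1 ≤ d) (h : IsTight H W x A B) :
    ConnOn H (reachSet H A x \ {x}) := by
  obtain ⟨u, hu, -, hconn⟩ := (connOn_reachSet A x).exists_connOn_diff_singleton
    (self_mem_reachSet A x) (hs.reachSet_diff_nonempty hd h.1)
  refine (ncard_componentSets_le (hs.reachSet_mem_componentSets h.1) (self_mem_reachSet A x) hu
    hconn).2 ?_
  have := h.2 _ _ _ (hs.moveLeft h.1 hu)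
  unfold coverPotential at this
  rw [hs.diff_insert_diff h.1 hu] at this
  omega

lemma isTight_moveLeft [Finite V] (hs : SwapSystem H d r W) (h : IsTight H W x A B) {u : V}
    (hu : u ∈ reachSet H A x) (hconn : ConnOn H (reachSet H A x \ {u})) :
    IsTight H W u A (insert u (B \ {x})) := by
  refine ⟨hs.moveLeft h.1 hu, fun y A' B' h' => le_trans ?_ (h.2 y A' B' h')⟩
  have := (ncard_componentSets_le (hs.reachSet_mem_componentSets h.1) (self_mem_reachSet A x) hu
    hconn).1
  unfold coverPotential
  rw [hs.diff_insert_diff h.1 hu]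
  omega

lemma _root_.ClosedIn.neighborSet_inter {A C : Set V} (hCA : C ⊆ A) (hC : ClosedIn H A C)
    (hy : y ∈ C) : H.neighborSet y ∩ A = H.neighborSet y ∩ C :=
  Set.Subset.antisymm (fun b hb => ⟨hb.1, hC y hy b hb.2 hb.1⟩)
    (Set.inter_subset_inter_right _ hCA)

lemma adj_iff_of_ncard_closedIn_eq [Finite V] {B' M : Set V} {y z u : V} {k : ℕ} (hMB : M ⊆ B')
    (hM : ClosedIn H B' M) (hy : y ∈ M) (hz : z ∉ M) (hu : u ∉ M)
    (h₁ : (H.neighborSet y ∩ insert u M).ncard = k)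
    (h₂ : (H.neighborSet y ∩ insert z B').ncard = k) : H.Adj y u ↔ H.Adj y z := by
  refine adj_iff_of_ncard_insert_eq hu hz h₁ ?_
  rw [← h₂]
  congr 1
  ext b
  constructor
  · rintro ⟨h, rfl | hb⟩
    · exact ⟨h, Set.mem_insert _ _⟩
    · exact ⟨h, Set.mem_insert_of_mem _ (hMB hb)⟩
  · rintro ⟨h, rfl | hb⟩
    · exact ⟨h, Set.mem_insert _ _⟩
    · exact ⟨h, Set.mem_insert_of_mem _ (hM y hy b hb h)⟩

theorem eq_top_of_reuse [Finite V] (hs : SwapSystem H d r W) (hH : H.Connected) (hd : 1 ≤ d)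
    (hr : 1 ≤ r) (hdr : 2 ≤ d ∨ 2 ≤ r) (hv : IsTight H W v A B) (hw : IsTight H W w A' B')
    (hL : reachSet H A v \ {v} = reachSet H A' w \ {w}) {u : V} (hu : u ∈ reachSet H B v)
    (huv : u ≠ v) (hMconn : ConnOn H (reachSet H B v \ {u}))
    (hMB : reachSet H B v \ {u} ⊆ B' \ {w})
    (hM : ClosedIn H (B' \ {w}) (reachSet H B v \ {u})) : H = ⊤ := by
  have hvM : v ∈ reachSet H B v \ {u} := ⟨self_mem_reachSet B v, huv.symm⟩
  obtain ⟨hvB', hvw⟩ := hMB hvM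
  have hvA' : v ∉ A' := fun h => hvw (hs.eq_of_mem hw.1 h hvB')
  have hLA : insert v (reachSet H A v \ {v}) = reachSet H A v := by
    rw [Set.insert_sdiff_singleton, Set.insert_eq_of_mem (self_mem_reachSet A v)]
  have hLA' : insert w (reachSet H A v \ {v}) = reachSet H A' w := by
    rw [hL, Set.insert_sdiff_singleton, Set.insert_eq_of_mem (self_mem_reachSet A' w)]
  have hN : ∀ y ∈ reachSet H A v \ {v}, (H.Adj y v ↔ H.Adj y w) := by
    intro y hy
    have hy' : y ∈ reachSet H A' w \ {w} := hL ▸ hy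
    refine adj_iff_of_ncard_insert_eq (k := d) (L := reachSet H A v \ {v}) (by simp)
      (by rw [hL]; simp) ?_ ?_
    · rw [hLA,
        ← (closedIn_reachSet A v).neighborSet_inter (reachSet_subset (hs.mem_left hv.1)) hy.1]
      exact hs.degLeft_of_mem hv.1 hy.1
    · rw [hLA', ← (closedIn_reachSet A' w).neighborSet_inter
        (reachSet_subset (hs.mem_left hw.1)) hy'.1]
      exact hs.degLeft_of_mem hw.1 hy'.1
  have hNw : ∀ z ∈ A', H.Adj w z → z ∈ reachSet H A v ∧ z ≠ v ∧ H.Adj v z := by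
    intro z hz hwz
    have hzL : z ∈ reachSet H A v \ {v} := by
      rw [hL]; exact ⟨mem_reachSet_of_adj hz hwz, hwz.ne'⟩
    exact ⟨hzL.1, hzL.2, ((hN z hzL).2 hwz.symm).symm⟩
  obtain ⟨z, hzA', hwz⟩ := hs.exists_adj_left hd hw.1
  obtain ⟨hzL, hzv, hvz⟩ := hNw z hzA' hwz
  have hzw := mem_reachSet_of_adj hzA' hwz
  have h₁ := hs.moveLeft hw.1 hzw
  rcases hdr with hd2 | hr2
  · obtain ⟨z', ⟨hwz', hz'A'⟩, hne⟩ := Set.exists_ne_of_one_lt_ncard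
      (by rw [hs.degLeft hw.1]; omega : 1 < (H.neighborSet w ∩ A').ncard) z
    obtain ⟨hz'L, hz'v, hvz'⟩ := hNw z' hz'A' hwz'
    have h₂ := hs.moveRight h₁ (mem_reachSet_of_adj (Set.mem_insert_of_mem _ ⟨hvB', hvw⟩) hvz.symm)
    have hz'₂ : z' ∈ reachSet H (insert v (A' \ {z})) v :=
      mem_reachSet_of_adj (Set.mem_insert_of_mem _ ⟨hz'A', hne⟩) hvz'
    have hw₂ : w ∈ reachSet H (insert v (A' \ {z})) v :=
      closedIn_reachSet _ _ _ hz'₂ w (Set.mem_insert_of_mem _ ⟨hs.mem_left hw.1, hwz.ne⟩)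
        (SimpleGraph.Adj.symm hwz')
    have hwv : H.Adj w v := (adj_iff_of_ncard_diff_eq hzA' hvA' (hs.degLeft hw.1)
      (hs.degLeft_of_mem h₂ hw₂)).1 hwz
    refine hs.eq_top_of_twin hH hd hw.1 (hs.symm.connOn_of_isTight hr hw.symm) hvB' hwv ?_
    have hsub : H.neighborSet w ∩ A' ⊆ H.neighborSet v ∩ insert v (A' \ {w}) := by
      rintro y ⟨hwy, hyA'⟩
      exact ⟨(hNw y hyA' hwy).2.2, Set.mem_insert_of_mem _ ⟨hyA', hwy.ne'⟩⟩
    have heq := Set.eq_of_subset_of_ncard_le hsub (by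
      rw [hs.degLeft hw.1, hs.degLeft_of_mem_right hw.1 (mem_reachSet_of_adj hvB' hwv)])
    intro y hyA' hyw
    refine ⟨fun hwy => (hNw y hyA' hwy).2.2, fun hvy => ?_⟩
    have : y ∈ H.neighborSet w ∩ A' := by
      rw [heq]; exact ⟨hvy, Set.mem_insert_of_mem _ ⟨hyA', hyw⟩⟩
    exact this.1
  · have hzB : z ∉ B := fun h =>
      hzv (hs.eq_of_mem hv.1 (reachSet_subset (hs.mem_left hv.1) hzL) h)
    have hEB := reachSet_subset (H := H) (hs.mem_right hv.1)
    have hsub : reachSet H B v \ {u} ⊆ reachSet H (insert z (B' \ {w})) z :=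
      hMconn.subset_reachSet (hMB.trans (Set.subset_insert _ _)) hvM
        (mem_reachSet_of_adj (Set.mem_insert_of_mem _ (hMB hvM)) hvz.symm)
    have hiff : ∀ y ∈ reachSet H B v \ {u}, (H.Adj y u ↔ H.Adj y z) := by
      intro y hy
      refine adj_iff_of_ncard_closedIn_eq (k := r) hMB hM hy (fun h => hzB (hEB h.1)) (by simp) ?_
        (hs.degRight_of_mem h₁ (hsub hy))
      rw [Set.insert_sdiff_singleton, Set.insert_eq_of_mem hu,
        ← (closedIn_reachSet B v).neighborSet_inter hEB hy.1]
      exact hs.degRight_of_mem hv.1 hy.1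
    obtain ⟨y, ⟨huy, hyB⟩, hyv⟩ := Set.exists_ne_of_one_lt_ncard
      (by rw [hs.degRight_of_mem hv.1 hu]; omega : 1 < (H.neighborSet u ∩ B).ncard) v
    have hyE : y ∈ reachSet H B v := closedIn_reachSet B v u hu y hyB huy
    have hyz : H.Adj y z := (hiff y ⟨hyE, huy.ne'⟩).1 (SimpleGraph.Adj.symm huy)
    refine hs.symm.eq_top_of_twin hH hr hv.1 (hs.connOn_of_isTight hd hv)
      (reachSet_subset (hs.mem_left hv.1) hzL) hvz ?_
    exact hs.twin_of_adj hv.1 (hs.symm.connOn_of_isTight hr hv.symm) hzL hzv hyE hyv hyz.symm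

/-- `y` lies in a component of `A \ {x}` that was left behind by an earlier tight cover, whose
common vertex now lies in a component of `B \ {x}` left behind by the exchange that followed. -/
def LeftBehind (H : SimpleGraph V) (W : V → Set V → Set V → Prop) (x : V) (A B T : Set V)
    (y : V) : Prop :=
  ∃ v A₀ B₀, IsTight H W v A₀ B₀ ∧ y ∈ reachSet H A₀ v \ {v} ∧
    reachSet H A₀ v \ {v} ⊆ T ∩ (A \ {x}) ∧ ClosedIn H (A \ {x}) (reachSet H A₀ v \ {v}) ∧
    ∃ u ∈ reachSet H B₀ v, u ≠ v ∧ ConnOn H (reachSet H B₀ v \ {u}) ∧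
      reachSet H B₀ v \ {u} ⊆ T ∩ (B \ {x}) ∧ ClosedIn H (B \ {x}) (reachSet H B₀ v \ {u})

theorem eq_top_of_leftBehind [Finite V] (hs : SwapSystem H d r W) (hH : H.Connected) (hd : 1 ≤ d)
    (hr : 1 ≤ r) (hdr : 2 ≤ d ∨ 2 ≤ r) (h : IsTight H W x A B) {T : Set V} (hy : y ∈ reachSet H A x)
    (hyx : y ≠ x) (hleft : LeftBehind H W x A B T y) : H = ⊤ := by
  obtain ⟨v, A₀, B₀, hv, hyL, hLT, hL, u, hu, huv, hMconn, hMB, hM⟩ := hleft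
  refine hs.eq_top_of_reuse hH hd hr hdr hv h ?_ hu huv hMconn
    (hMB.trans Set.inter_subset_right) hM
  exact (hs.connOn_of_isTight hd hv).eq_of_closedIn (hs.connOn_of_isTight hd h)
    (hLT.trans Set.inter_subset_right)
    (Set.sdiff_subset_sdiff_left (reachSet_subset (hs.mem_left h.1))) hL
    (fun a ha b hb hab => ⟨closedIn_reachSet A x a ha.1 b hb.1 hab, hb.2⟩) hyL ⟨hy, hyx⟩

theorem eq_top_of_marked [Finite V] (n : ℕ) : ∀ {d r : ℕ} {W : V → Set V → Set V → Prop} {x : V}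
    {A B T : Set V}, Tᶜ.ncard = n → SwapSystem H d r W → H.Connected → 1 ≤ d → 1 ≤ r →
    (2 ≤ d ∨ 2 ≤ r) → IsTight H W x A B → x ∈ T →
    (∀ y ∈ T, y ∈ A → y ≠ x →
      (y ∈ reachSet H A x ∧ reachSet H A x ⊆ T) ∨ LeftBehind H W x A B T y) →
    (∀ y ∈ T, y ∈ B → y ≠ x → LeftBehind H (fun x A B => W x B A) x B A T y) → H = ⊤ := by
  induction n using Nat.strong_induction_on with
  | _ n ih =>
  intro d r W x A B T hn hs hH hd hr hdr h hxT hleft hright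
  set E := reachSet H B x with hE
  by_cases hmeet : ∃ y ∈ T, y ∈ E ∧ y ≠ x
  · obtain ⟨y, hyT, hyE, hyx⟩ := hmeet
    exact hs.symm.eq_top_of_leftBehind hH hr hd hdr.symm h.symm hyE hyx
      (hright y hyT (reachSet_subset (hs.mem_right h.1) hyE) hyx)
  push Not at hmeet
  have hEB : E ⊆ B := reachSet_subset (hs.mem_right h.1)
  have hxE : x ∈ E := self_mem_reachSet B x
  obtain ⟨u, hu, hux, hconn⟩ := (connOn_reachSet B x).exists_connOn_diff_singleton
    hxE (hs.symm.reachSet_diff_nonempty hr h.1)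
  have huT : u ∉ T := fun huT => hux (hmeet u huT hu)
  have hEu : reachSet H B u = E := reachSet_eq_of_mem (hs.mem_right h.1) hu
  have hA : insert u (A \ {x}) \ {u} = A \ {x} := hs.symm.diff_insert_diff h.1 hu
  have hTE : ∀ X ⊆ T ∩ (B \ {x}), ClosedIn H (B \ {x}) X →
      X ⊆ (T ∪ E) ∩ (B \ {u}) ∧ ClosedIn H (B \ {u}) X := by
    intro X hX hXc
    refine ⟨fun y hy => ⟨Or.inl (hX hy).1, (hX hy).2.1, fun hyu => huT (hyu ▸ (hX hy).1)⟩, ?_⟩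
    intro a ha b hb hab
    by_cases hbx : b = x
    · subst hbx
      exact absurd (hmeet a (hX ha).1 (mem_reachSet_of_adj (hX ha).2.1 hab.symm)) (hX ha).2.2
    · exact hXc a ha b ⟨hb.1, hbx⟩ hab
  refine ih _ ?_ (T := T ∪ E) rfl hs.symm hH hr hd hdr.symm
    (hs.symm.isTight_moveLeft h.symm hu hconn) (Or.inr hu) ?_ ?_
  · rw [← hn]
    refine Set.ncard_lt_ncard ⟨Set.compl_subset_compl.2 Set.subset_union_left, fun hsub => ?_⟩
    exact hsub huT (Or.inr hu)
  · intro y hy hyB hyu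
    by_cases hyE : y ∈ E
    · left
      rw [hEu]
      exact ⟨hyE, Set.subset_union_right⟩
    · right
      obtain ⟨v, A₀, B₀, hv, hyL, hLT, hL, u', hu', huv', hMconn, hMB, hM⟩ :=
        hright y (hy.resolve_right hyE) hyB fun h => hyE (h ▸ hxE)
      have hT := hTE _ hLT hL
      refine ⟨v, A₀, B₀, hv, hyL, hT.1, hT.2, u', hu', huv', hMconn, ?_, ?_⟩
      · rw [hA]
        exact hMB.trans (Set.inter_subset_inter_left _ Set.subset_union_left)
      · rw [hA]
        exact hM
  · intro y hy hyA hyu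
    have hyA' : y ∈ A \ {x} := hyA.resolve_left hyu
    have hyT : y ∈ T := hy.resolve_right fun hyE => hyA'.2 (hs.eq_of_mem h.1 hyA'.1 (hEB hyE))
    rcases hleft y hyT hyA'.1 hyA'.2 with ⟨hyR, hRT⟩ | hold
    · refine ⟨x, A, B, h, ⟨hyR, hyA'.2⟩, ?_, ?_, u, hu, hux, hconn,
        fun z hz => ⟨Or.inr hz.1, hEB hz.1, hz.2⟩,
        fun a ha b hb hab => ⟨closedIn_reachSet B x a ha.1 b hb.1 hab, hb.2⟩⟩
      · rw [hA]
        exact fun z hz => ⟨Or.inl (hRT hz.1), reachSet_subset (hs.mem_left h.1) hz.1, hz.2⟩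
      · rw [hA]
        exact fun a ha b hb hab => ⟨closedIn_reachSet A x a ha.1 b hb.1 hab, hb.2⟩
    · obtain ⟨v, A₀, B₀, hv, hyL, hLT, hL, u', hu', huv', hMconn, hMB, hM⟩ := hold
      have hT := hTE _ hMB hM
      refine ⟨v, A₀, B₀, hv, hyL, ?_, ?_, u', hu', huv', hMconn, hT.1, hT.2⟩
      · rw [hA]
        exact hLT.trans (Set.inter_subset_inter_left _ Set.subset_union_left)
      · rw [hA]
        exact hL

/-- A connected graph carrying a nonempty swap system with parameters other than `(1, 1)` is
complete. -/
theorem eq_top [Finite V] (hs : SwapSystem H d r W) (hH : H.Connected) (hd : 1 ≤ d) (hr : 1 ≤ r)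
    (hdr : 2 ≤ d ∨ 2 ≤ r) (h : W x A B) : H = ⊤ := by
  obtain ⟨⟨x₀, A₀, B₀⟩, h₀, hmin⟩ := Set.Finite.exists_minimalFor
    (fun t : V × Set V × Set V => coverPotential H t.1 t.2.1 t.2.2)
    {t : V × Set V × Set V | W t.1 t.2.1 t.2.2} (Set.toFinite _) ⟨(x, A, B), h⟩
  have htight : IsTight H W x₀ A₀ B₀ := by
    refine ⟨h₀, fun y A' B' h' => ?_⟩
    by_contra! hlt
    exact absurd (hmin (j := (y, A', B')) h' hlt.le) (not_le.2 hlt)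
  exact eq_top_of_marked _ (T := {x₀}) rfl hs hH hd hr hdr htight rfl
    (fun y hy _ hyx => absurd hy hyx) (fun y hy _ hyx => absurd hy hyx)

end SwapSystem
end SwapSystem

section Copies

variable {α V : Type*} {G : SimpleGraph α} {H : SimpleGraph V}

/-- `f` embeds `G` as a subgraph of `H` with all vertices in `S`. -/
def IsCopyIn (G : SimpleGraph α) (H : SimpleGraph V) (S : Set V) (f : α → V) : Prop :=
  Function.Injective f ∧ (∀ a b, G.Adj a b → H.Adj (f a) (f b)) ∧ ∀ a, f a ∈ S

lemma hasCopy_induce_iff {S : Set V} : HasCopy G (H.induce S) ↔ ∃ f, IsCopyIn G H S f := by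
  constructor
  · rintro ⟨f, hf⟩
    exact ⟨fun a => (f a : V), Subtype.val_injective.comp hf, fun a b hab => f.map_adj hab,
      fun a => (f a).2⟩
  · rintro ⟨f, hf, hadj, hS⟩
    exact ⟨⟨fun a => ⟨f a, hS a⟩, fun {a b} hab => hadj a b hab⟩,
      fun a b hab => hf (congrArg Subtype.val hab)⟩

lemma ncard_neighborSet_eq_degree [Fintype V] [DecidableRel H.Adj] (v : V) :
    (H.neighborSet v).ncard = H.degree v := by
  rw [← H.card_neighborSet_eq_degree, Set.ncard_eq_toFinset_card', Set.toFinset_card]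

lemma IsCopyIn.minDegree_le [Fintype α] [DecidableRel G.Adj] [Finite V] {S : Set V} {f : α → V}
    (hf : IsCopyIn G H S f) (a : α) : G.minDegree ≤ (H.neighborSet (f a) ∩ S).ncard := by
  refine (G.minDegree_le_degree a).trans ?_
  rw [← ncard_neighborSet_eq_degree, ← Set.ncard_image_of_injective _ hf.1]
  refine Set.ncard_le_ncard ?_
  rintro _ ⟨b, hb, rfl⟩
  exact ⟨hf.2.1 a b hb, hf.2.2 b⟩

lemma IsCopyIn.mem_range_of_adj [Fintype α] [DecidableRel G.Adj] [Finite V] {S : Set V} {f : α → V}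
    (hf : IsCopyIn G H S f) {y z : V} (hy : y ∈ Set.range f) (hz : z ∈ S) (hyz : H.Adj y z)
    (hdeg : (H.neighborSet y ∩ S).ncard ≤ G.minDegree) : z ∈ Set.range f := by
  obtain ⟨a, rfl⟩ := hy
  have hsub : f '' G.neighborSet a ⊆ H.neighborSet (f a) ∩ S := by
    rintro _ ⟨b, hb, rfl⟩
    exact ⟨hf.2.1 a b hb, hf.2.2 b⟩
  have heq := Set.eq_of_subset_of_ncard_le hsub (by
    rw [Set.ncard_image_of_injective _ hf.1, ncard_neighborSet_eq_degree]
    exact hdeg.trans (G.minDegree_le_degree a))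
  have : z ∈ f '' G.neighborSet a := by rw [heq]; exact ⟨hyz, hz⟩
  exact Set.image_subset_range _ _ this

lemma IsCopyIn.range_subset_of_closedIn {S X : Set V} {f : α → V} (hf : IsCopyIn G H S f)
    (hG : G.Connected) (hX : ClosedIn H S X) {a : α} (ha : f a ∈ X) : Set.range f ⊆ X := by
  have := hG.eq_univ_of_closed (X := f ⁻¹' X) ha
    fun b hb c hbc => hX _ hb _ (hf.2.2 c) (hf.2.1 b c hbc)
  rintro _ ⟨b, rfl⟩
  have hb : b ∈ f ⁻¹' X := this ▸ Set.mem_univ b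
  exact hb

lemma MaxFreeSubset.exists_isCopyIn_insert [Finite V] {S : Set V} (hS : MaxFreeSubset G H S) {x : V}
    (hx : x ∉ S) : ∃ f, IsCopyIn G H (insert x S) f := by
  by_contra h
  have := hS.2 (insert x S) fun h' => h (hasCopy_induce_iff.1 h')
  rw [Set.ncard_insert_of_notMem hx] at this
  omega

lemma MaxFreeSubset.mem_range [Finite V] {A : Set V} {x : V} (hS : MaxFreeSubset G H (A \ {x}))
    {f : α → V} (hf : IsCopyIn G H A f) : x ∈ Set.range f := by
  by_contra h
  exact hS.1 (hasCopy_induce_iff.2 ⟨f, hf.1, hf.2.1, fun a => ⟨hf.2.2 a, fun h' => h ⟨a, h'⟩⟩⟩)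

lemma ncard_inter_add_ncard_inter_compl_le [Fintype V] [DecidableRel H.Adj] (S : Set V) (y : V) :
    (H.neighborSet y ∩ S).ncard + (H.neighborSet y ∩ Sᶜ).ncard ≤ H.maxDegree := by
  rw [← Set.sdiff_eq, Set.ncard_inter_add_ncard_sdiff_eq_ncard, ncard_neighborSet_eq_degree]
  exact H.degree_le_maxDegree y

lemma neighborSet_inter_insert_self (S : Set V) (y : V) :
    H.neighborSet y ∩ insert y S = H.neighborSet y ∩ S :=
  Set.inter_insert_of_notMem (by simp)

lemma MaxFreeSubset.minDegree_le [Fintype α] [DecidableRel G.Adj] [Finite V] {S : Set V}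
    (hS : MaxFreeSubset G H S) {y : V} (hy : y ∉ S) :
    G.minDegree ≤ (H.neighborSet y ∩ S).ncard := by
  obtain ⟨f, hf⟩ := hS.exists_isCopyIn_insert hy
  have hS' : MaxFreeSubset G H (insert y S \ {y}) := by
    rwa [Set.insert_sdiff_self_of_notMem hy]
  obtain ⟨a, ha⟩ := hS'.mem_range hf
  have := hf.minDegree_le a
  rwa [ha, neighborSet_inter_insert_self] at this

lemma MaxFreeSubset.ncard_inter_compl_le [Fintype α] [DecidableRel G.Adj] [Fintype V]
    [DecidableRel H.Adj] {S : Set V} (hS : MaxFreeSubset G H S) {y : V} (hy : y ∉ S) :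
    (H.neighborSet y ∩ Sᶜ).ncard ≤ H.maxDegree - G.minDegree := by
  have := hS.minDegree_le hy
  have := ncard_inter_add_ncard_inter_compl_le (H := H) S y
  omega

/-- The `r`-regular connected components of `H ∖ S`. -/
def regularComponents (H : SimpleGraph V) (S : Set V) (r : ℕ) : Set (Set V) :=
  {X | X ∈ componentSets H Sᶜ ∧ ∀ y ∈ X, (H.neighborSet y ∩ Sᶜ).ncard = r}

lemma connOn_verts {H' : H.Subgraph} (h : H'.Connected) : ConnOn H H'.verts := by
  refine ⟨h.nonempty, fun X hX ⟨p, hp⟩ hXc v hv => ?_⟩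
  have := h.coe.eq_univ_of_closed (X := Subtype.val ⁻¹' X) (x := ⟨p, hX hp⟩) hp
    fun a ha b hab => hXc a ha b b.2 (H'.adj_sub hab)
  have hv' : (⟨v, hv⟩ : H'.verts) ∈ (Subtype.val ⁻¹' X : Set H'.verts) := this ▸ Set.mem_univ _
  exact hv'

lemma ConnOn.connected_induce {X : Set V} (hX : ConnOn H X) :
    ((⊤ : H.Subgraph).induce X).Connected := by
  obtain ⟨p, hp⟩ := hX.1
  set K := (⊤ : H.Subgraph).induce X
  rw [SimpleGraph.Subgraph.connected_iff']
  have key := hX.2 {q | ∃ hq : q ∈ X, K.coe.Reachable ⟨p, hp⟩ ⟨q, hq⟩} (fun q hq => hq.1)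
    ⟨p, hp, SimpleGraph.Reachable.refl _⟩ (by
      rintro a ⟨ha, hpa⟩ b hb hab
      refine ⟨hb, hpa.trans (SimpleGraph.Adj.reachable ?_)⟩
      simp [K, ha, hb, hab])
  have : Nonempty K.verts := ⟨⟨p, hp⟩⟩
  exact ⟨fun a b => ((key a.2).2.symm.trans (key b.2).2 : K.coe.Reachable a b)⟩

lemma IsRegConnSubgraphOff.neighborSet_eq [Finite V] {S : Set V} {r : ℕ}
    (hS : ∀ y, y ∉ S → (H.neighborSet y ∩ Sᶜ).ncard ≤ r) {K : H.Subgraph}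
    (hK : IsRegConnSubgraphOff H S r K) {v : V} (hv : v ∈ K.verts) :
    K.neighborSet v = H.neighborSet v ∩ Sᶜ := by
  obtain ⟨hsub, -, hreg⟩ := hK
  refine Set.eq_of_subset_of_ncard_le
    (fun w hw => ⟨K.adj_sub hw, hsub (K.edge_vert (K.adj_symm hw))⟩) ?_
  rw [hreg v hv]
  exact hS v (hsub hv)

lemma IsRegConnSubgraphOff.verts_mem_regularComponents [Finite V] {S : Set V} {r : ℕ}
    (hS : ∀ y, y ∉ S → (H.neighborSet y ∩ Sᶜ).ncard ≤ r) {K : H.Subgraph}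
    (hK : IsRegConnSubgraphOff H S r K) : K.verts ∈ regularComponents H S r := by
  refine ⟨⟨hK.1, connOn_verts hK.2.1, fun a ha b hb hab => ?_⟩, fun y hy => ?_⟩
  · have : b ∈ K.neighborSet a := by rw [hK.neighborSet_eq hS ha]; exact ⟨hab, hb⟩
    exact K.edge_vert (K.adj_symm this)
  · rw [← hK.neighborSet_eq hS hy]
    exact hK.2.2 y hy

lemma regCount_eq_ncard [Finite V] {S : Set V} {r : ℕ}
    (hS : ∀ y, y ∉ S → (H.neighborSet y ∩ Sᶜ).ncard ≤ r) :
    regCount H S r = (regularComponents H S r).ncard := by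
  have hle : ∀ K L : H.Subgraph, IsRegConnSubgraphOff H S r K → IsRegConnSubgraphOff H S r L →
      K.verts = L.verts → ∀ v w, K.Adj v w → L.Adj v w := by
    intro K L hK hL hKL v w h
    have hv : v ∈ K.verts := K.edge_vert h
    have : w ∈ L.neighborSet v := by
      rw [hL.neighborSet_eq hS (hKL ▸ hv), ← hK.neighborSet_eq hS hv]
      exact h
    exact this
  have hinj : Set.InjOn SimpleGraph.Subgraph.verts
      {H' : H.Subgraph | IsRegConnSubgraphOff H S r H'} := by
    intro K hK L hL hKL
    refine SimpleGraph.Subgraph.ext hKL ?_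
    ext v w
    exact ⟨hle K L hK hL hKL v w, hle L K hL hK hKL.symm v w⟩
  unfold regCount
  rw [← hinj.ncard_image]
  congr 1
  ext X
  constructor
  · rintro ⟨K, hK, rfl⟩
    exact hK.verts_mem_regularComponents hS
  · rintro ⟨⟨hXS, hXconn, hXc⟩, hreg⟩
    refine ⟨(⊤ : H.Subgraph).induce X, ⟨hXS, hXconn.connected_induce, fun v hv => ?_⟩, rfl⟩
    rw [← hreg v hv]
    congr 1
    ext w
    have hv' : v ∈ X := hv
    simp only [SimpleGraph.Subgraph.mem_neighborSet, SimpleGraph.Subgraph.induce_adj,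
      SimpleGraph.Subgraph.top_adj, Set.mem_inter_iff, SimpleGraph.mem_neighborSet]
    exact ⟨fun h => ⟨h.2.2, hXS h.2.1⟩, fun h => ⟨hv', hXc v hv' w h.2 h.1, h.1⟩⟩

end Copies

section SwapState

variable {α V : Type*} {G : SimpleGraph α} {H : SimpleGraph V} {r : ℕ}

/-- `S` is a maximum `G`-free subset with the fewest `r`-regular components of `H ∖ S`. -/
def RegMinimal (G : SimpleGraph α) (H : SimpleGraph V) (r : ℕ) (S : Set V) : Prop :=
  MaxFreeSubset G H S ∧ ∀ T, MaxFreeSubset G H T →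
    (regularComponents H S r).ncard ≤ (regularComponents H T r).ncard

/-- The cover of the vertex set by `A = S ∪ {x}` and `B = V ∖ S`, where `S` is `RegMinimal` and `x`
lies in an `r`-regular component of `H ∖ S`. -/
def SwapState (G : SimpleGraph α) (H : SimpleGraph V) (r : ℕ) (x : V) (A B : Set V) : Prop :=
  x ∈ A ∧ B = insert x Aᶜ ∧ RegMinimal G H r (A \ {x}) ∧
    ∃ X ∈ regularComponents H (A \ {x}) r, x ∈ X

lemma compl_diff_singleton_eq (A : Set V) (z : V) : (A \ {z})ᶜ = insert z Aᶜ := by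
  ext w
  simp only [Set.mem_compl_iff, Set.mem_sdiff, Set.mem_singleton_iff, Set.mem_insert_iff]
  tauto

namespace SwapState

variable {x y z : V} {A B : Set V}

lemma maxFreeSubset (h : SwapState G H r y A B) (hz : z ∈ A)
    (hall : ∀ f, IsCopyIn G H A f → z ∈ Set.range f) : MaxFreeSubset G H (A \ {z}) := by
  refine ⟨fun hc => ?_, fun T hT => ?_⟩
  · obtain ⟨f, hf⟩ := hasCopy_induce_iff.1 hc
    obtain ⟨a, ha⟩ := hall f ⟨hf.1, hf.2.1, fun a => (hf.2.2 a).1⟩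
    exact (hf.2.2 a).2 ha
  · have := h.2.2.1.1.2 T hT
    rwa [Set.ncard_sdiff_singleton_of_mem h.1, ← Set.ncard_sdiff_singleton_of_mem hz] at this

lemma degRight (h : SwapState G H r x A B) : (H.neighborSet x ∩ B).ncard = r := by
  obtain ⟨hx, rfl, -, X, hX, hxX⟩ := h
  rw [← compl_diff_singleton_eq]
  exact hX.2 x hxX

lemma exists_isCopyIn [Finite V] (h : SwapState G H r x A B) : ∃ f, IsCopyIn G H A f := by
  have := h.2.2.1.1.exists_isCopyIn_insert (x := x) (by simp)
  rwa [Set.insert_sdiff_singleton, Set.insert_eq_of_mem h.1] at this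

lemma card_le [Finite V] (h : SwapState G H r x A B) (hG : G.Connected) {X : Set V} (hxX : x ∈ X)
    (hX : ClosedIn H A X) : Nat.card α ≤ X.ncard := by
  obtain ⟨f, hf⟩ := h.exists_isCopyIn
  obtain ⟨a, ha⟩ := h.2.2.1.1.mem_range hf
  rw [← Set.ncard_univ, ← Set.ncard_image_of_injective _ hf.1, Set.image_univ]
  exact Set.ncard_le_ncard (hf.range_subset_of_closedIn hG hX (a := a) (ha ▸ hxX))

variable [Fintype α] [DecidableRel G.Adj] [Fintype V] [DecidableRel H.Adj]

lemma mem_regularComponents (hΔ : H.maxDegree = G.minDegree + r)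
    (h : SwapState G H r y A B) {X : Set V} (hX : X ∈ regularComponents H (A \ {z}) r)
    (hzX : z ∉ X) :
    X ∈ regularComponents H (A \ {y}) r := by
  obtain ⟨⟨hXS, hXconn, hXc⟩, hreg⟩ := hX
  simp only [compl_diff_singleton_eq] at hXS hXc hreg
  have hXA : X ⊆ Aᶜ := fun a ha => (hXS ha).resolve_left fun h => hzX (h ▸ ha)
  have hN : ∀ a ∈ X, (H.neighborSet a ∩ Aᶜ).ncard = r := by
    intro a ha
    rw [← hreg a ha, Set.inter_insert_of_notMem]
    exact fun haz => hzX (hXc a ha z (Set.mem_insert _ _) haz)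
  have hay : ∀ a ∈ X, y ∉ H.neighborSet a := by
    intro a ha hay
    have hle := h.2.2.1.1.ncard_inter_compl_le (y := a) fun haA => hXA ha haA.1
    rw [compl_diff_singleton_eq, Set.inter_insert_of_mem hay,
      Set.ncard_insert_of_notMem fun hyA => hyA.2 h.1, hN a ha] at hle
    omega
  refine ⟨⟨?_, hXconn, ?_⟩, ?_⟩
  · rw [compl_diff_singleton_eq]
    exact hXA.trans (Set.subset_insert _ _)
  · rw [compl_diff_singleton_eq]
    rintro a ha b (rfl | hb) hab
    · exact absurd hab (hay a ha)
    · exact hXc a ha b (Set.mem_insert_of_mem _ hb) hab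
  · intro a ha
    rw [compl_diff_singleton_eq, Set.inter_insert_of_notMem (hay a ha), hN a ha]

lemma of_mem_range (hΔ : H.maxDegree = G.minDegree + r)
    (h : SwapState G H r y A B) (hz : z ∈ A) (hall : ∀ f, IsCopyIn G H A f → z ∈ Set.range f) :
    SwapState G H r z A (insert z Aᶜ) := by
  have hmax := h.maxFreeSubset hz hall
  by_cases hzy : z = y
  · subst hzy
    exact ⟨hz, rfl, h.2.2⟩
  obtain ⟨X₀, hX₀, hyX₀⟩ := h.2.2.2
  have hsub : ∀ X ∈ regularComponents H (A \ {z}) r, z ∉ X →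
      X ∈ regularComponents H (A \ {y}) r \ {X₀} := by
    refine fun X hX hzX => ⟨h.mem_regularComponents hΔ hX hzX, ?_⟩
    rintro rfl
    exact hX.1.1 hyX₀ ⟨h.1, fun h' => hzy h'.symm⟩
  have hcard := Set.ncard_sdiff_singleton_add_one hX₀
  have hex : ∃ X ∈ regularComponents H (A \ {z}) r, z ∈ X := by
    by_contra! hcon
    have h₁ := Set.ncard_le_ncard fun X hX => hsub X hX (hcon X hX)
    have h₂ := h.2.2.1.2 _ hmax
    omega
  refine ⟨hz, rfl, ⟨hmax, fun T hT => (?_ : _ ≤ _).trans (h.2.2.1.2 T hT)⟩, hex⟩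
  obtain ⟨X, hX, hzX⟩ := hex
  have hsub' : regularComponents H (A \ {z}) r ⊆
      insert X (regularComponents H (A \ {y}) r \ {X₀}) := by
    intro Y hY
    by_cases hzY : z ∈ Y
    · exact Or.inl (hY.1.2.1.eq_of_closedIn hX.1.2.1 hY.1.1 hX.1.1 hY.1.2.2 hX.1.2.2 hzY hzX)
    · exact Or.inr (hsub Y hY hzY)
  have h₁ := Set.ncard_le_ncard hsub'
  have h₂ := Set.ncard_insert_le X (regularComponents H (A \ {y}) r \ {X₀})
  omega

lemma degLeft (hΔ : H.maxDegree = G.minDegree + r) (h : SwapState G H r x A B) :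
    (H.neighborSet x ∩ A).ncard = G.minDegree := by
  have h₁ := h.2.2.1.1.minDegree_le (y := x) (by simp)
  have h₂ := ncard_inter_add_ncard_inter_compl_le (H := H) (A \ {x}) x
  have h₃ := h.degRight
  rw [h.2.1, ← compl_diff_singleton_eq] at h₃
  rw [← neighborSet_inter_insert_self, Set.insert_sdiff_singleton, Set.insert_eq_of_mem h.1]
    at h₁ h₂
  omega

lemma moveLeft_aux (hΔ : H.maxDegree = G.minDegree + r) (h : SwapState G H r x A B)
    (hy : y ∈ reachSet H A x) :
    SwapState G H r y A (insert y Aᶜ) ∧ ∀ f, IsCopyIn G H A f → y ∈ Set.range f := by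
  induction hy with
  | refl =>
    have hall : ∀ f, IsCopyIn G H A f → x ∈ Set.range f := fun f hf => h.2.2.1.1.mem_range hf
    exact ⟨h.of_mem_range hΔ h.1 hall, hall⟩
  | tail _ hyz ih =>
    obtain ⟨hW, hall⟩ := ih
    have hall' := fun f (hf : IsCopyIn G H A f) =>
      hf.mem_range_of_adj (hall f hf) hyz.2 hyz.1 (hW.degLeft hΔ).le
    exact ⟨hW.of_mem_range hΔ hyz.2 hall', hall'⟩

theorem swapSystem (hΔ : H.maxDegree = G.minDegree + r) :
    SwapSystem H G.minDegree r (SwapState G H r) where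
  inter := by
    rintro x A B ⟨hx, rfl, -⟩
    rw [Set.inter_insert_of_mem hx, Set.inter_compl_self]
    exact insert_empty_eq x
  union := by
    rintro x A B ⟨hx, rfl, -⟩
    rw [Set.union_insert, Set.union_compl_self, Set.insert_eq_of_mem (Set.mem_univ x)]
  degLeft h := h.degLeft hΔ
  degRight h := h.degRight
  moveLeft := by
    intro x A B y h hy
    convert (h.moveLeft_aux hΔ hy).1 using 2
    rw [h.2.1]
    exact Set.insert_sdiff_self_of_notMem fun h' => h' h.1
  moveRight := by
    rintro x A B y ⟨hx, rfl, hmin, X, hX, hxX⟩ hy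
    rw [← compl_diff_singleton_eq] at hy ⊢
    have hyX := reachSet_subset_of_closedIn hxX hX.1.2.2 hy
    have hyA : y ∉ A \ {x} := hX.1.1 hyX
    rw [SwapState, Set.insert_sdiff_self_of_notMem hyA]
    refine ⟨Set.mem_insert _ _, ?_, hmin, X, hX, hyX⟩
    rw [← compl_diff_singleton_eq, Set.insert_sdiff_self_of_notMem hyA]

end SwapState

lemma exists_swapState [Fintype α] [DecidableRel G.Adj] [Fintype V] [DecidableRel H.Adj]
    (hΔ : H.maxDegree = G.minDegree + r) {S : Set V} (hS : MaxFreeSubset G H S)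
    (hreg : ∀ T, MaxFreeSubset G H T → regCount H S r ≤ regCount H T r) {H₀ : H.Subgraph}
    (hH₀ : IsRegConnSubgraphOff H S r H₀) : ∃ x A B, SwapState G H r x A B := by
  have hbound : ∀ T, MaxFreeSubset G H T → ∀ y ∉ T, (H.neighborSet y ∩ Tᶜ).ncard ≤ r := by
    intro T hT y hy
    have := hT.ncard_inter_compl_le hy
    omega
  obtain ⟨x, hx⟩ := hH₀.2.1.nonempty
  have hxS : x ∉ S := hH₀.1 hx
  refine ⟨x, insert x S, _, Set.mem_insert _ _, rfl, ?_⟩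
  rw [Set.insert_sdiff_self_of_notMem hxS]
  refine ⟨⟨hS, fun T hT => ?_⟩, H₀.verts, hH₀.verts_mem_regularComponents (hbound S hS), hx⟩
  rw [← regCount_eq_ncard (hbound S hS), ← regCount_eq_ncard (hbound T hT)]
  exact hreg T hT

end SwapState

section Structure

variable {α V : Type*} {G : SimpleGraph α} {H : SimpleGraph V}

lemma SimpleGraph.Connected.nonempty_iso_of_injective [Finite V] [Nonempty α] (hH : H.Connected)
    (f : G →g H) (hf : Function.Injective f)
    (hdeg : ∀ a, (H.neighborSet (f a)).ncard ≤ (G.neighborSet a).ncard) : Nonempty (G ≃g H) := by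
  have himg : ∀ a, f '' G.neighborSet a = H.neighborSet (f a) := by
    refine fun a => Set.eq_of_subset_of_ncard_le ?_ ?_
    · rintro _ ⟨b, hb, rfl⟩
      exact f.map_adj hb
    · rw [Set.ncard_image_of_injective _ hf]
      exact hdeg a
  have hadj : ∀ a w, H.Adj (f a) w → ∃ b, G.Adj a b ∧ f b = w := by
    intro a w haw
    have : w ∈ f '' G.neighborSet a := by rw [himg a]; exact haw
    exact this
  have hclosed : ∀ v ∈ Set.range f, ∀ w, H.Adj v w → w ∈ Set.range f := by
    rintro _ ⟨a, rfl⟩ w haw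
    obtain ⟨b, -, rfl⟩ := hadj a w haw
    exact Set.mem_range_self b
  have huniv := hH.eq_univ_of_closed (Set.mem_range_self (Classical.arbitrary α)) hclosed
  refine ⟨⟨Equiv.ofBijective f ⟨hf, Set.range_eq_univ.1 huniv⟩,
    fun {a b} => ⟨fun h => ?_, f.map_adj⟩⟩⟩
  obtain ⟨c, hac, hc⟩ := hadj a _ h
  rwa [← hf hc]

lemma nonempty_iso_top_of_card_le [Fintype α] [Nonempty α] [DecidableRel G.Adj]
    (hcard : Nat.card α ≤ G.minDegree + 1) :
    Nonempty (G ≃g (⊤ : SimpleGraph (Fin (G.minDegree + 1)))) := by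
  have hnbr : ∀ a, G.neighborSet a = {a}ᶜ := by
    refine fun a => Set.eq_of_subset_of_ncard_le (fun b hb => hb.ne') ?_
    have h₁ := Set.ncard_add_ncard_compl {a}
    have h₂ := G.minDegree_le_degree a
    rw [Set.ncard_singleton] at h₁
    rw [ncard_neighborSet_eq_degree]
    omega
  have hG : G = ⊤ := by
    ext a b
    rw [← SimpleGraph.mem_neighborSet, hnbr a]
    simp [eq_comm]
  obtain ⟨a⟩ := ‹Nonempty α›
  have hlt := (G.minDegree_le_degree a).trans_lt (G.degree_lt_card_verts a)
  rw [← Nat.card_eq_fintype_card] at hlt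
  have e := Finite.equivFinOfCardEq (hcard.antisymm hlt)
  subst hG
  exact ⟨Iso.completeGraph e⟩

lemma exists_iso_cycleGraph [Fintype V] (hH : H.Connected)
    (hdeg : ∀ v, (H.neighborSet v).ncard = 2) : ∃ n, 3 ≤ n ∧ Nonempty (H ≃g cycleGraph n) := by
  classical
  obtain ⟨v⟩ := hH.nonempty
  have hnontriv : Nontrivial V := by
    obtain ⟨w, hw⟩ := Set.nonempty_of_ncard_ne_zero (s := H.neighborSet v) (by rw [hdeg v]; decide)
    exact ⟨v, w, SimpleGraph.Adj.ne hw⟩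
  have hcyc : ¬ H.IsAcyclic := by
    intro hac
    have h₁ := SimpleGraph.IsTree.minDegree_eq_one_of_nontrivial ⟨hH, hac⟩
    obtain ⟨w, hw⟩ := H.exists_minimal_degree_vertex
    have h₂ := hdeg w
    rw [ncard_neighborSet_eq_degree] at h₂
    omega
  rw [SimpleGraph.isAcyclic_iff_free_cycleGraph] at hcyc
  simp only [SimpleGraph.Free, not_forall, not_not] at hcyc
  obtain ⟨n, hn, ⟨f⟩⟩ := hcyc
  obtain ⟨m, rfl⟩ := Nat.exists_eq_add_of_le' hn
  refine ⟨m + 3, hn, ?_⟩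
  obtain ⟨e⟩ := hH.nonempty_iso_of_injective f.toHom f.injective' fun a => by
    rw [hdeg, ncard_neighborSet_eq_degree, cycleGraph_degree_three_le]
  exact ⟨e.symm⟩

lemma two_mul_ncard_lt_of_independent [Fintype V] {S : Set V} {x : V}
    (hdeg : ∀ v, (H.neighborSet v).ncard = 2) (hS : ∀ u ∈ S, ∀ v ∈ S, ¬ H.Adj u v) (hx : x ∉ S)
    (hxS : (H.neighborSet x ∩ S).ncard < 2) : 2 * S.ncard < Nat.card V := by
  classical
  have hsum := Finset.sum_card_bipartiteAbove_eq_sum_card_bipartiteBelow H.Adj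
    (s := S.toFinset) (t := Sᶜ.toFinset)
  have hbelow : ∀ v, (Finset.bipartiteBelow H.Adj S.toFinset v).card =
      (H.neighborSet v ∩ S).ncard := by
    intro v
    rw [← Set.ncard_coe_finset]
    congr 1
    ext u
    simp [Finset.bipartiteBelow, and_comm, H.adj_comm]
  have habove : ∀ u ∈ S.toFinset, (Finset.bipartiteAbove H.Adj Sᶜ.toFinset u).card = 2 := by
    intro u hu
    rw [← hdeg u, ← Set.ncard_coe_finset]
    congr 1
    ext v
    simp only [Finset.bipartiteAbove, Finset.coe_filter, Set.mem_toFinset, Set.mem_compl_iff,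
      Set.mem_ofPred_eq, SimpleGraph.mem_neighborSet, and_iff_right_iff_imp]
    exact fun huv hv => hS u (Set.mem_toFinset.1 hu) v hv huv
  rw [Finset.sum_congr rfl habove] at hsum
  have hlt : ∑ v ∈ Sᶜ.toFinset, (Finset.bipartiteBelow H.Adj S.toFinset v).card <
      ∑ _v ∈ Sᶜ.toFinset, 2 := by
    refine Finset.sum_lt_sum (fun v _ => ?_) ⟨x, by simpa using hx, by rwa [hbelow]⟩
    rw [hbelow, ← hdeg v]
    exact Set.ncard_le_ncard Set.inter_subset_left
  simp only [Finset.sum_const, smul_eq_mul, ← Set.ncard_eq_toFinset_card'] at hsum hlt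
  have := Set.ncard_add_ncard_compl S
  omega

lemma MaxFreeSubset.card_le_two_mul [Finite V] {S : Set V} (hS : MaxFreeSubset G H S)
    (c : H.Coloring Bool) {a b : α} (hab : G.Adj a b) : Nat.card V ≤ 2 * S.ncard := by
  have hfree : ∀ i, {v | c v = i}.ncard ≤ S.ncard := by
    refine fun i => hS.2 _ fun h => ?_
    obtain ⟨f, hf⟩ := hasCopy_induce_iff.1 h
    exact c.valid (hf.2.1 a b hab) ((hf.2.2 a).trans (hf.2.2 b).symm)
  have hcompl : {v | c v = true}ᶜ = {v | c v = false} := by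
    ext v
    simp
  have h := Set.ncard_add_ncard_compl {v | c v = true}
  rw [hcompl] at h
  have h₁ := hfree true
  have h₂ := hfree false
  omega

end Structure

section SwapState

variable {α V : Type*} [Fintype α] {G : SimpleGraph α} [DecidableRel G.Adj] [Fintype V]
  {H : SimpleGraph V} [DecidableRel H.Adj] {r : ℕ} {x : V} {A B : Set V}

namespace SwapState

theorem iso_of_eq_zero (hΔ : H.maxDegree = G.minDegree) (h : SwapState G H r x A B)
    (hG : G.Connected) (hH : H.Connected) : Nonempty (H ≃g G) := by
  obtain ⟨f, hf⟩ := h.exists_isCopyIn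
  have := hG.nonempty
  obtain ⟨e⟩ := hH.nonempty_iso_of_injective ⟨f, fun {a b} => hf.2.1 a b⟩ hf.1 fun a => by
    rw [ncard_neighborSet_eq_degree, ncard_neighborSet_eq_degree]
    exact (H.degree_le_maxDegree _).trans (hΔ.le.trans (G.minDegree_le_degree a))
  exact ⟨e.symm⟩

theorem iso_of_eq_top (hΔ : H.maxDegree = G.minDegree + r) (h : SwapState G H r x A B)
    (hG : G.Connected) (htop : H = ⊤) :
    Nonempty (G ≃g (⊤ : SimpleGraph (Fin (G.minDegree + 1)))) ∧
      Nonempty (H ≃g (⊤ : SimpleGraph (Fin (H.maxDegree + 1)))) := by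
  have hnbr : H.neighborSet x = {x}ᶜ := by
    ext y
    simp [htop, eq_comm]
  have := hG.nonempty
  constructor
  · refine nonempty_iso_top_of_card_le ?_
    have h₁ := h.card_le hG h.1 fun _ _ b hb _ => hb
    have h₂ := h.degLeft hΔ
    rw [hnbr, Set.inter_comm, ← Set.sdiff_eq] at h₂
    rw [← h₂, Set.ncard_sdiff_singleton_add_one h.1]
    exact h₁
  · have h₁ := (swapSystem hΔ).ncard_neighborSet h
    have h₂ := Set.ncard_add_ncard_compl {x}
    rw [← hnbr, h₁, ← hΔ, Set.ncard_singleton, add_comm] at h₂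
    have e := Finite.equivFinOfCardEq h₂.symm
    have e' := Iso.completeGraph e
    exact ⟨htop ▸ e'⟩

theorem iso_odd_cycle (hΔ : H.maxDegree = G.minDegree + 1) (hd : G.minDegree = 1)
    (h : SwapState G H 1 x A B) (hG : G.Connected) (hH : H.Connected) :
    Nonempty (G ≃g (⊤ : SimpleGraph (Fin 2))) ∧
      ∃ ℓ : ℕ, 1 ≤ ℓ ∧ Nonempty (H ≃g cycleGraph (2 * ℓ + 1)) := by
  have hs := swapSystem (G := G) (H := H) hΔ
  have hdeg : ∀ v, (H.neighborSet v).ncard = 2 := by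
    intro v
    obtain ⟨A', B', h'⟩ := hs.exists_state hH h v
    rw [hs.ncard_neighborSet h', hd]
  obtain ⟨z, hz⟩ := Set.ncard_eq_one.1 ((h.degLeft hΔ).trans hd)
  have hxz : H.Adj x z ∧ z ∈ A := by
    have : z ∈ H.neighborSet x ∩ A := by rw [hz]; rfl
    exact this
  have hzA : H.neighborSet z ∩ A = {x} := by
    obtain ⟨w, hw⟩ := Set.ncard_eq_one.1
      (((h.moveLeft_aux hΔ (mem_reachSet_of_adj hxz.2 hxz.1)).1.degLeft hΔ).trans hd)
    have : x ∈ H.neighborSet z ∩ A := ⟨hxz.1.symm, h.1⟩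
    rw [hw] at this ⊢
    rw [Set.mem_singleton_iff.1 this]
  have hclosed : ClosedIn H A {x, z} := by
    rintro a (rfl | rfl) b hb hab
    · have : b ∈ H.neighborSet a ∩ A := ⟨hab, hb⟩
      rw [hz] at this
      exact Or.inr this
    · have : b ∈ H.neighborSet a ∩ A := ⟨hab, hb⟩
      rw [hzA] at this
      exact Or.inl this
  have hcard := (h.card_le hG (Set.mem_insert _ _) hclosed).trans_eq (Set.ncard_pair hxz.1.ne)
  have := hG.nonempty
  obtain ⟨e⟩ := nonempty_iso_top_of_card_le (G := G) (by rw [hd]; exact hcard)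
  have e₂ : G ≃g (⊤ : SimpleGraph (Fin 2)) := by rwa [hd] at e
  refine ⟨⟨e₂⟩, ?_⟩
  obtain ⟨n, hn, ⟨φ⟩⟩ := exists_iso_cycleGraph hH hdeg
  have hodd : ¬ Even n := by
    intro heven
    obtain ⟨b, hb⟩ := (G.degree_pos_iff_exists_adj (Classical.arbitrary α)).1
      (by have := G.minDegree_le_degree (Classical.arbitrary α); omega)
    have h₁ := h.2.2.1.1.card_le_two_mul
      ((cycleGraph.bicoloring_of_even n heven).comp φ.toHom) hb
    have h₂ := two_mul_ncard_lt_of_independent (x := x) hdeg (S := A \ {x}) ?_ (by simp) ?_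
    · omega
    · intro u hu v hv huv
      refine h.2.2.1.1.1 (hasCopy_induce_iff.2 ⟨fun a => ![u, v] (e₂ a), ?_, ?_, ?_⟩)
      · refine Function.Injective.comp ?_ e₂.injective
        intro i j
        fin_cases i <;> fin_cases j <;> simp [huv.ne, huv.ne']
      · intro a b hab
        have hne := e₂.injective.ne hab.ne
        change H.Adj (![u, v] (e₂ a)) (![u, v] (e₂ b))
        revert hne
        generalize e₂ a = i
        generalize e₂ b = j
        fin_cases i <;> fin_cases j <;> simp [huv, huv.symm]
      · intro a
        change ![u, v] (e₂ a) ∈ A \ {x}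
        generalize e₂ a = i
        fin_cases i
        · exact hu
        · exact hv
    · rw [← neighborSet_inter_insert_self, Set.insert_sdiff_singleton, Set.insert_eq_of_mem h.1,
        h.degLeft hΔ]
      omega
  obtain ⟨ℓ, rfl⟩ := Nat.not_even_iff_odd.1 hodd
  exact ⟨ℓ, by omega, ⟨φ⟩⟩

end SwapState

end SwapState

/-- **Lemma (part (c)).**  With `S` as before, if `H ∖ S` has a connected
`(Δ(H) - d)`-regular subgraph, then either `G ≅ K_{d+1}` and `H ≅ K_{Δ(H)+1}`, or
`G ≅ K₂` and `H ≅ C_{2ℓ+1}` for some positive integer `ℓ`, or `H ≅ G`. -/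
theorem regular_subgraph_forces_structure
    {α : Type*} [Fintype α] (G : SimpleGraph α) [DecidableRel G.Adj]
    {V : Type*} [Fintype V] (H : SimpleGraph V) [DecidableRel H.Adj]
    (hGconn : G.Connected) (hHconn : H.Connected)
    (hd : 1 ≤ G.minDegree) (hΔd : G.minDegree ≤ H.maxDegree)
    (S : Set V) (hS : MaxFreeSubset G H S)
    (hreg : ∀ T : Set V, MaxFreeSubset G H T →
      regCount H S (H.maxDegree - G.minDegree) ≤ regCount H T (H.maxDegree - G.minDegree))
    (hcomp : ∀ T : Set V, MaxFreeSubset G H T →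
      regCount H T (H.maxDegree - G.minDegree) = regCount H S (H.maxDegree - G.minDegree) →
      compCount H S ≤ compCount H T)
    (H₀ : H.Subgraph) (hH₀ : IsRegConnSubgraphOff H S (H.maxDegree - G.minDegree) H₀) :
    (Nonempty (G ≃g (⊤ : SimpleGraph (Fin (G.minDegree + 1)))) ∧
      Nonempty (H ≃g (⊤ : SimpleGraph (Fin (H.maxDegree + 1))))) ∨
    (Nonempty (G ≃g (⊤ : SimpleGraph (Fin 2))) ∧
      ∃ ℓ : ℕ, 1 ≤ ℓ ∧ Nonempty (H ≃g cycleGraph (2 * ℓ + 1))) ∨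
    Nonempty (H ≃g G) := by
  have hΔ : H.maxDegree = G.minDegree + (H.maxDegree - G.minDegree) := by omega
  obtain ⟨x, A, B, h⟩ := exists_swapState hΔ hS hreg hH₀
  generalize H.maxDegree - G.minDegree = r at hΔ h
  rcases Nat.eq_zero_or_pos r with rfl | hr
  · exact Or.inr (Or.inr (h.iso_of_eq_zero hΔ hGconn hHconn))
  by_cases hdr : 2 ≤ G.minDegree ∨ 2 ≤ r
  · exact Or.inl (h.iso_of_eq_top hΔ hGconn
      ((SwapState.swapSystem hΔ).eq_top hHconn hd hr hdr h))
  · obtain rfl : r = 1 := by omega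
    exact Or.inr (Or.inl (h.iso_odd_cycle hΔ (by omega) hGconn hHconn))
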